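/- Let U ⊆ ℂⁿ be open and let wᵢ, aᵢ : U → ℂ be holomorphic. Let Γ₁, Γ₂ : U → U be holomorphic maps, f₁, f₂ : U → ℂ nowhere-vanishing holomorphic functions with Γₗ*ω = fₗ·ω (componentwise: Σⱼ (wⱼ∘Γₗ)·∂ᵢ(Γₗ)ⱼ = fₗ·wᵢ) for ℓ = 1, 2, and g₁, g₂ : U → ℂ holomorphic with (Γₗ*α)ᵢ − aᵢ + ∂ᵢfₗ/fₗ = gₗ·wᵢ for all i and ℓ = 1, 2. Then, setting f₁₂ := (f₁∘Γ₂)·f₂, the composition Γ₁∘Γ₂ satisfies (Γ₁∘Γ₂)*ω = f₁₂·ω, and the associated coefficient is g₁₂ = (g₁∘Γ₂)·f₂ + g₂: for all i, ((Γ₁∘Γ₂)*α)ᵢ − aᵢ + ∂ᵢf₁₂/f₁₂ = ((g₁∘Γ₂)·f₂ + g₂)·wᵢ. -/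

import Mathlib

open scoped BigOperators

/-- The `i`-th complex partial derivative of `f : ℂⁿ → ℂ` at `x`. -/
noncomputable def pd {n : ℕ} (i : Fin n) (f : (Fin n → ℂ) → ℂ) (x : Fin n → ℂ) : ℂ :=
  fderiv ℂ f x (Pi.single i 1)

/-- The `i`-th component of the pullback `Γ*η` of the 1-form `η = Σⱼ hⱼ dxⱼ`
under `Γ : ℂⁿ → ℂⁿ`: `(Γ*η)ᵢ = Σⱼ (hⱼ ∘ Γ) · ∂ᵢΓⱼ`. -/
noncomputable def pullback1 {n : ℕ} (Γ : (Fin n → ℂ) → (Fin n → ℂ))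
    (h : Fin n → (Fin n → ℂ) → ℂ) (i : Fin n) (x : Fin n → ℂ) : ℂ :=
  ∑ j, h j (Γ x) * pd i (fun y => Γ y j) x

/-- Chain rule for partial derivatives. -/
theorem pd_comp {n : ℕ} (i : Fin n) {F : (Fin n → ℂ) → ℂ} {G : (Fin n → ℂ) → (Fin n → ℂ)}
    {x : Fin n → ℂ} (hF : DifferentiableAt ℂ F (G x)) (hG : DifferentiableAt ℂ G x) :
    pd i (fun y => F (G y)) x = ∑ k, pd k F (G x) * pd i (fun y => G y k) x := by
  have hcoord (k : Fin n) : pd i (fun y => G y k) x = fderiv ℂ G x (Pi.single i 1) k := by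
    rw [pd, fderiv_apply hG k]
    rfl
  have hcomp : pd i (fun y => F (G y)) x = fderiv ℂ F (G x) (fderiv ℂ G x (Pi.single i 1)) := by
    rw [pd, show (fun y => F (G y)) = F ∘ G from rfl, fderiv_comp x hF hG]
    rfl
  rw [hcomp]
  conv_lhs => rw [pi_eq_sum_univ' (fderiv ℂ G x (Pi.single i 1)), map_sum]
  refine Finset.sum_congr rfl fun k _ => ?_
  rw [map_smul, smul_eq_mul, hcoord, pd, mul_comm]

/-- Leibniz rule for partial derivatives. -/
theorem pd_mul {n : ℕ} (i : Fin n) {F G : (Fin n → ℂ) → ℂ} {x : Fin n → ℂ}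
    (hF : DifferentiableAt ℂ F x) (hG : DifferentiableAt ℂ G x) :
    pd i (fun y => F y * G y) x = F x * pd i G x + G x * pd i F x := by
  simp [pd, fderiv_fun_mul hF hG]

/-- Pullback of 1-forms is contravariantly functorial. -/
theorem pullback1_comp {n : ℕ} {Γ₁ Γ₂ : (Fin n → ℂ) → (Fin n → ℂ)}
    (h : Fin n → (Fin n → ℂ) → ℂ) (i : Fin n) {x : Fin n → ℂ}
    (h₁ : DifferentiableAt ℂ Γ₁ (Γ₂ x)) (h₂ : DifferentiableAt ℂ Γ₂ x) :
    pullback1 (Γ₁ ∘ Γ₂) h i x = pullback1 Γ₂ (pullback1 Γ₁ h) i x := by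
  have hchain (j : Fin n) : pd i (fun y => Γ₁ (Γ₂ y) j) x =
      ∑ k, pd k (fun y => Γ₁ y j) (Γ₂ x) * pd i (fun y => Γ₂ y k) x :=
    pd_comp (F := fun y => Γ₁ y j) i (differentiableAt_pi.1 h₁ j) h₂
  simp only [pullback1, Function.comp_apply, hchain, Finset.mul_sum, Finset.sum_mul]
  rw [Finset.sum_comm]
  simp only [mul_assoc]

/-- Cocycle rule for the coefficients `f_Γ` and `g_Γ`: if
`Γₗ*ω = fₗ·ω` and `Γₗ*α − α + dfₗ/fₗ = gₗ·ω` for `ℓ = 1,2`, then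
`(Γ₁∘Γ₂)*ω = ((f₁∘Γ₂)·f₂)·ω` and the coefficient of the composition is
`g₁₂ = (g₁∘Γ₂)·f₂ + g₂`. -/
theorem cocycle_f_g {n : ℕ}
    (U : Set (Fin n → ℂ)) (hU : IsOpen U)
    (w α : Fin n → (Fin n → ℂ) → ℂ)
    (hw : ∀ i, DifferentiableOn ℂ (w i) U)
    (hα : ∀ i, DifferentiableOn ℂ (α i) U)
    (Γ₁ Γ₂ : (Fin n → ℂ) → (Fin n → ℂ))
    (hΓ₁ : DifferentiableOn ℂ Γ₁ U) (hΓ₁maps : Set.MapsTo Γ₁ U U)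
    (hΓ₂ : DifferentiableOn ℂ Γ₂ U) (hΓ₂maps : Set.MapsTo Γ₂ U U)
    (f₁ f₂ : (Fin n → ℂ) → ℂ)
    (hf₁ : DifferentiableOn ℂ f₁ U) (hf₁0 : ∀ x ∈ U, f₁ x ≠ 0)
    (hf₂ : DifferentiableOn ℂ f₂ U) (hf₂0 : ∀ x ∈ U, f₂ x ≠ 0)
    (hpullω₁ : ∀ i, ∀ x ∈ U, pullback1 Γ₁ w i x = f₁ x * w i x)
    (hpullω₂ : ∀ i, ∀ x ∈ U, pullback1 Γ₂ w i x = f₂ x * w i x)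
    (g₁ g₂ : (Fin n → ℂ) → ℂ)
    (hg₁ : DifferentiableOn ℂ g₁ U) (hg₂ : DifferentiableOn ℂ g₂ U)
    (hpullα₁ : ∀ i, ∀ x ∈ U,
      pullback1 Γ₁ α i x - α i x + pd i f₁ x / f₁ x = g₁ x * w i x)
    (hpullα₂ : ∀ i, ∀ x ∈ U,
      pullback1 Γ₂ α i x - α i x + pd i f₂ x / f₂ x = g₂ x * w i x) :
    (∀ i, ∀ x ∈ U,
      pullback1 (Γ₁ ∘ Γ₂) w i x = (f₁ (Γ₂ x) * f₂ x) * w i x) ∧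
    (∀ i, ∀ x ∈ U,
      pullback1 (Γ₁ ∘ Γ₂) α i x - α i x
          + pd i (fun y => f₁ (Γ₂ y) * f₂ y) x / (f₁ (Γ₂ x) * f₂ x)
        = (g₁ (Γ₂ x) * f₂ x + g₂ x) * w i x) := by
  have hd₂ : ∀ x ∈ U, DifferentiableAt ℂ Γ₂ x := fun x hx => hΓ₂.differentiableAt (hU.mem_nhds hx)
  have hnhds : ∀ x ∈ U, U ∈ nhds (Γ₂ x) := fun x hx => hU.mem_nhds (hΓ₂maps hx)
  refine ⟨fun i x hx => ?_, fun i x hx => ?_⟩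
  · rw [pullback1_comp w i (hΓ₁.differentiableAt (hnhds x hx)) (hd₂ x hx), mul_assoc,
      ← hpullω₂ i x hx]
    simp only [pullback1, Finset.mul_sum]
    refine Finset.sum_congr rfl fun k _ => ?_
    rw [← mul_assoc, ← hpullω₁ k _ (hΓ₂maps hx)]
    rfl
  · have hF := hf₁.differentiableAt (hnhds x hx)
    have hne₁ := hf₁0 _ (hΓ₂maps hx)
    have hne₂ := hf₂0 x hx
    have hpull : pullback1 (Γ₁ ∘ Γ₂) α i x = g₁ (Γ₂ x) * pullback1 Γ₂ w i x
        + pullback1 Γ₂ α i x - pd i (fun y => f₁ (Γ₂ y)) x / f₁ (Γ₂ x) := by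
      rw [pullback1_comp α i (hΓ₁.differentiableAt (hnhds x hx)) (hd₂ x hx),
        pd_comp i hF (hd₂ x hx), pullback1, pullback1, pullback1, Finset.mul_sum,
        Finset.sum_div, ← Finset.sum_add_distrib, ← Finset.sum_sub_distrib]
      refine Finset.sum_congr rfl fun k _ => ?_
      linear_combination pd i (fun y => Γ₂ y k) x * hpullα₁ k _ (hΓ₂maps hx)
    have hlog : pd i (fun y => f₁ (Γ₂ y) * f₂ y) x / (f₁ (Γ₂ x) * f₂ x)
        = pd i (fun y => f₁ (Γ₂ y)) x / f₁ (Γ₂ x) + pd i f₂ x / f₂ x := by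
      rw [pd_mul (F := fun y => f₁ (Γ₂ y)) i (hF.comp x (hd₂ x hx))
        (hf₂.differentiableAt (hU.mem_nhds hx))]
      field_simp
      ring
    rw [hpull, hlog, hpullω₂ i x hx]
    linear_combination hpullα₂ i x hx
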